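/- For every n ≥ 1, writing R_1 = Σ_{V(T)=n} JD(T) and R_2 = Σ_{V(T)=n} JD(T)², one has (n³ + 7n² + 16n + 12)·(b_n·R_2 − R_1²) = 2n·(2n² − n − 1)·b_n²; equivalently, the variance of the sum-of-jump-distances statistic JD over the uniform distribution on full binary trees with n internal vertices equals 2n(2n² − n − 1)/(n³ + 7n² + 16n + 12). -/

import Mathlib

inductive BTree : Type
  | leaf : BTree
  | node : BTree → BTree → BTree

namespace BTree

/-- number of internal vertices -/
def V : BTree → ℕ
  | leaf => 0
  | node l r => V l + V r + 1

/-- depth of the rightmost leaf -/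
def D : BTree → ℕ
  | leaf => 0
  | node _ r => 1 + D r

/-- number of jumps -/
def J : BTree → ℕ
  | leaf => 0
  | node leaf r => J r
  | node (node l₁ r₁) r => J (node l₁ r₁) + J r + 1

/-- sum of jump distances -/
def JD : BTree → ℕ
  | leaf => 0
  | node l r => JD l + JD r + D l

end BTree

namespace BTree

theorem JD_add_D (T : BTree) : T.JD + T.D = T.V := by
  induction T with
  | leaf => rfl
  | node l r hl hr => simp only [JD, D, V]; omega

theorem finite_V (n : ℕ) : {T : BTree | T.V = n}.Finite := by
  induction n using Nat.strong_induction_on with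
  | _ n ih =>
    have hlt : {T : BTree | T.V < n}.Finite := by
      have : {T : BTree | T.V < n} = ⋃ i ∈ Set.Iio n, {T : BTree | T.V = i} := by
        ext T; simp
      rw [this]
      exact (Set.finite_Iio n).biUnion (fun i hi => ih i hi)
    refine ((Set.finite_singleton leaf).union (hlt.image2 node hlt)).subset ?_
    rintro T hT
    cases T with
    | leaf => left; rfl
    | node l r =>
      right
      simp only [Set.mem_ofPred_eq, V] at hT
      exact ⟨l, by simp only [Set.mem_ofPred_eq]; omega, r, by simp only [Set.mem_ofPred_eq]; omega, rfl⟩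

noncomputable def trees (n : ℕ) : Finset BTree := (finite_V n).toFinset

theorem mem_trees {n : ℕ} {T : BTree} : T ∈ trees n ↔ T.V = n := by
  simp [trees]

theorem sum_trees_zero (f : BTree → ℚ) : ∑ T ∈ trees 0, f T = f leaf := by
  have : trees 0 = {leaf} := by
    ext T
    rw [mem_trees, Finset.mem_singleton]
    cases T <;> simp [V]
  simp [this]

theorem sum_trees_succ (f : BTree → ℚ) (n : ℕ) :
    ∑ T ∈ trees (n + 1), f T =
      ∑ p ∈ Finset.HasAntidiagonal.antidiagonal n, ∑ l ∈ trees p.1, ∑ r ∈ trees p.2, f (node l r) := by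
  classical
  have : trees (n + 1) = (Finset.HasAntidiagonal.antidiagonal n).biUnion
      (fun p => (trees p.1 ×ˢ trees p.2).image (fun q => node q.1 q.2)) := by
    ext T
    simp only [Finset.mem_biUnion, Finset.mem_image, Finset.mem_product, mem_trees,
      Finset.HasAntidiagonal.mem_antidiagonal, Prod.exists]
    cases T with
    | leaf => simp [V]
    | node l r =>
      constructor
      · intro h
        simp only [V] at h
        exact ⟨l.V, r.V, by omega, l, r, ⟨rfl, rfl⟩, rfl⟩
      · rintro ⟨i, j, h, a, c, ⟨h1, h2⟩, h3⟩
        rw [← h3]; simp only [V]; omega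
  rw [this, Finset.sum_biUnion]
  · refine Finset.sum_congr rfl fun p _ => ?_
    rw [Finset.sum_image, Finset.sum_product]
    rintro ⟨a, c⟩ _ ⟨a2, c2⟩ _ h
    simpa using h
  · rintro ⟨i, j⟩ _ ⟨i2, j2⟩ _ hne
    rw [Function.onFun, Finset.disjoint_left]
    intro T h1 h2
    simp only [Finset.mem_image, Finset.mem_product, mem_trees, Prod.exists] at h1 h2
    obtain ⟨a, c, ⟨h1, h2⟩, rfl⟩ := h1
    obtain ⟨a2, c2, ⟨h3, h4⟩, h5⟩ := h2
    injection h5 with h5 h6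
    subst h5 h6
    exact hne (by rw [← h1, ← h2, ← h3, ← h4])

theorem conv0 (n : ℕ) : ∑ p ∈ Finset.HasAntidiagonal.antidiagonal n, (catalan p.1 : ℚ) * catalan p.2
    = catalan (n + 1) := by
  rw [catalan_succ']; push_cast; rfl

theorem conv1 (n : ℕ) : ∑ p ∈ Finset.HasAntidiagonal.antidiagonal n, (catalan p.1 : ℚ) * catalan (p.2 + 1)
    = catalan (n + 2) - catalan (n + 1) := by
  have h := conv0 (n + 1)
  rw [Finset.Nat.sum_antidiagonal_succ'] at h
  simp only [catalan_zero, Nat.cast_one, mul_one] at h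
  linarith

theorem conv2 (n : ℕ) : ∑ p ∈ Finset.HasAntidiagonal.antidiagonal n, (catalan p.1 : ℚ) * catalan (p.2 + 2)
    = catalan (n + 3) - catalan (n + 2) - catalan (n + 1) := by
  have h := conv1 (n + 1)
  rw [Finset.Nat.sum_antidiagonal_succ'] at h
  simp only [zero_add, catalan_one, Nat.cast_one, mul_one] at h
  linarith

theorem M0 (n : ℕ) : ∑ T ∈ trees n, (1 : ℚ) = catalan n := by
  induction n using Nat.strong_induction_on with
  | _ n ih =>
    cases n with
    | zero => rw [sum_trees_zero]; simp
    | succ n =>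
      rw [sum_trees_succ, ← conv0]
      refine Finset.sum_congr rfl fun p hp => ?_
      rw [Finset.HasAntidiagonal.mem_antidiagonal] at hp
      rw [ih p.2 (by omega), ← ih p.1 (by omega), Finset.sum_mul]
      simp

theorem M1 (n : ℕ) : ∑ T ∈ trees n, (T.D : ℚ) = catalan (n + 1) - catalan n := by
  induction n using Nat.strong_induction_on with
  | _ n ih =>
    cases n with
    | zero => rw [sum_trees_zero]; simp [D]
    | succ n =>
      rw [sum_trees_succ, ← conv1]
      refine Finset.sum_congr rfl fun p hp => ?_
      rw [Finset.HasAntidiagonal.mem_antidiagonal] at hp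
      simp only [D, Nat.cast_add, Nat.cast_one, Finset.sum_add_distrib]
      rw [ih p.2 (by omega), M0, ← M0 p.1, Finset.sum_mul, ← Finset.sum_add_distrib]
      exact Finset.sum_congr rfl fun _ _ => by ring

theorem M2 (n : ℕ) : ∑ T ∈ trees n, (T.D : ℚ) ^ 2
    = 2 * catalan (n + 2) - 5 * catalan (n + 1) + catalan n := by
  induction n using Nat.strong_induction_on with
  | _ n ih =>
    cases n with
    | zero => rw [sum_trees_zero]; norm_num [D, catalan_two]
    | succ n =>
      have e : (2 * catalan (n + 1 + 2) - 5 * catalan (n + 1 + 1) + catalan (n + 1) : ℚ)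
          = 2 * (catalan (n + 3) - catalan (n + 2) - catalan (n + 1))
            - 3 * (catalan (n + 2) - catalan (n + 1)) := by ring_nf
      rw [sum_trees_succ, e, ← conv2 n, ← conv1 n, Finset.mul_sum, Finset.mul_sum,
        ← Finset.sum_sub_distrib]
      refine Finset.sum_congr rfl fun p hp => ?_
      rw [Finset.HasAntidiagonal.mem_antidiagonal] at hp
      have h : ∀ r : BTree, ((1 + r.D : ℕ) : ℚ) ^ 2 = 1 + 2 * (r.D : ℚ) + (r.D : ℚ) ^ 2 := by
        intro r; push_cast; ring
      simp only [D, h, Finset.sum_add_distrib, ← Finset.mul_sum]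
      rw [ih p.2 (by omega), M0, M1, ← M0 p.1, Finset.mul_sum, Finset.sum_mul, Finset.sum_mul,
        Finset.mul_sum, Finset.mul_sum, ← Finset.sum_add_distrib, ← Finset.sum_add_distrib,
        ← Finset.sum_sub_distrib]
      exact Finset.sum_congr rfl fun _ _ => by ring

theorem catalan_rec (n : ℕ) : ((n : ℚ) + 2) * catalan (n + 1) = 2 * (2 * n + 1) * catalan n := by
  have h1 := succ_mul_catalan_eq_centralBinom n
  have h2 := succ_mul_catalan_eq_centralBinom (n + 1)
  have h3 := Nat.succ_mul_centralBinom_succ n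
  rw [← h1, ← h2] at h3
  have h4 : (((n + 1) * ((n + 1 + 1) * catalan (n + 1)) : ℕ) : ℚ)
      = ((2 * (2 * n + 1) * ((n + 1) * catalan n) : ℕ) : ℚ) := by exact_mod_cast h3
  push_cast at h4
  have h5 : (n : ℚ) + 1 ≠ 0 := by positivity
  apply mul_left_cancel₀ h5
  linarith

end BTree

/-- The variance of the sum-of-jump-distances statistic over the uniform
distribution on full binary trees with n ≥ 1 internal vertices is
2n(2n² − n − 1)/(n³ + 7n² + 16n + 12): with R₁ = Σ JD(T), R₂ = Σ JD(T)²,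
one has (n³ + 7n² + 16n + 12)·(bₙ·R₂ − R₁²) = 2n·(2n² − n − 1)·bₙ². -/
theorem stmt_15 (n : ℕ) (hn : 1 ≤ n)
    (b : ℚ) (hb : b = (Nat.card {T : BTree // T.V = n} : ℚ))
    (R₁ : ℚ) (hR₁ : R₁ = ∑ᶠ T ∈ {T : BTree | T.V = n}, (T.JD : ℚ))
    (R₂ : ℚ) (hR₂ : R₂ = ∑ᶠ T ∈ {T : BTree | T.V = n}, (T.JD : ℚ) ^ 2) :
    ((n : ℚ) ^ 3 + 7 * n ^ 2 + 16 * n + 12) * (b * R₂ - R₁ ^ 2) =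
      2 * (n : ℚ) * (2 * (n : ℚ) ^ 2 - n - 1) * b ^ 2 := by
  have hJ : ∀ T ∈ BTree.trees n, (T.JD : ℚ) = n - T.D := by
    intro T hT
    rw [BTree.mem_trees] at hT
    have := BTree.JD_add_D T
    rw [hT] at this
    rw [← this]; push_cast; ring
  have hbc : b = catalan n := by
    rw [hb, ← BTree.M0, Finset.sum_const, nsmul_eq_mul, mul_one]
    have : Nat.card {T : BTree // T.V = n} = (BTree.trees n).card := by
      rw [BTree.trees, ← Set.ncard_eq_toFinset_card _ (BTree.finite_V n)]; rfl
    rw [this]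
  have h1 : R₁ = n * catalan n - (catalan (n + 1) - catalan n) := by
    rw [hR₁, finsum_mem_eq_finite_toFinset_sum _ (BTree.finite_V n)]
    change ∑ T ∈ BTree.trees n, _ = _
    rw [Finset.sum_congr rfl hJ, ← BTree.M1, ← BTree.M0, Finset.mul_sum,
      ← Finset.sum_sub_distrib]
    exact Finset.sum_congr rfl fun _ _ => by ring
  have h2 : R₂ = n ^ 2 * catalan n - 2 * n * (catalan (n + 1) - catalan n)
      + (2 * catalan (n + 2) - 5 * catalan (n + 1) + catalan n) := by
    rw [hR₂, finsum_mem_eq_finite_toFinset_sum _ (BTree.finite_V n)]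
    change ∑ T ∈ BTree.trees n, _ = _
    rw [Finset.sum_congr rfl (fun T hT => by rw [hJ T hT]), ← BTree.M2, ← BTree.M1, ← BTree.M0,
      Finset.mul_sum, Finset.mul_sum,
      ← Finset.sum_sub_distrib, ← Finset.sum_add_distrib]
    exact Finset.sum_congr rfl fun _ _ => by ring
  have r1 := BTree.catalan_rec n
  have r2 := BTree.catalan_rec (n + 1)
  push_cast at r2
  rw [h1, h2, hbc]
  have p2 : (n : ℚ) + 2 ≠ 0 := by positivity
  have p3 : (n : ℚ) + 1 + 2 ≠ 0 := by positivity
  have e1 : (catalan (n + 1) : ℚ) = 2 * (2 * n + 1) * catalan n / (n + 2) := by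
    rw [eq_div_iff p2]; linarith
  have e2 : (catalan (n + 2) : ℚ) = 2 * (2 * (n + 1) + 1) * catalan (n + 1) / (n + 1 + 2) := by
    rw [eq_div_iff p3]; linarith
  rw [e2, e1]
  field_simp
  ring
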